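/- Let N be a finite set, M ⊆ N, and r a set function on M belonging to K_ℓ(M). Then the lifting λ(r), defined by λ(r)(S) := r(S∩M) for S ⊆ N, belongs to K_ℓ(N), and r generates an extreme ray of the cone K_ℓ(M) if and only if λ(r) generates an extreme ray of the cone K_ℓ(N). -/

import Mathlib

/-- A set function `m` on the finite set `N` is supermodular if
`m A + m B ≤ m (A ∪ B) + m (A ∩ B)` for all `A, B ⊆ N`. -/
def Supermodular {α : Type*} [DecidableEq α] (N : Finset α) (m : Finset α → ℝ) : Prop :=
  ∀ A ⊆ N, ∀ B ⊆ N, m A + m B ≤ m (A ∪ B) + m (A ∩ B)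

/-- `Kl N m`: `m` is an ℓ-standardized supermodular set function on `N`. -/
def Kl {α : Type*} [DecidableEq α] (N : Finset α) (m : Finset α → ℝ) : Prop :=
  Supermodular N m ∧ m ∅ = 0 ∧ ∀ i ∈ N, m {i} = 0

/-- `m` generates an extreme ray of the cone `{m | C m}` of set functions on `N`. -/
def ExtremeRay {α : Type*} (N : Finset α) (C : (Finset α → ℝ) → Prop)
    (m : Finset α → ℝ) : Prop :=
  C m ∧ (∃ S ⊆ N, m S ≠ 0) ∧
  ∀ m₁ m₂ : Finset α → ℝ, C m₁ → C m₂ → (∀ S ⊆ N, m S = m₁ S + m₂ S) →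
    ∃ a b : ℝ, 0 ≤ a ∧ 0 ≤ b ∧ (∀ S ⊆ N, m₁ S = a * m S) ∧ (∀ S ⊆ N, m₂ S = b * m S)

/-- Supermodular functions vanishing at `∅` are superadditive on disjoint sets. -/
theorem Kl.add_le_union {α : Type*} [DecidableEq α] {N : Finset α} {m : Finset α → ℝ}
    (hm : Kl N m) {A B : Finset α} (hA : A ⊆ N) (hB : B ⊆ N) (hAB : Disjoint A B) :
    m A + m B ≤ m (A ∪ B) := by
  have h := hm.1 A hA B hB
  rwa [Finset.disjoint_iff_inter_eq_empty.mp hAB, hm.2.1, add_zero] at h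

theorem Kl.nonneg {α : Type*} [DecidableEq α] {N : Finset α} {m : Finset α → ℝ}
    (hm : Kl N m) {S : Finset α} (hS : S ⊆ N) : 0 ≤ m S := by
  induction S using Finset.induction_on with
  | empty => exact hm.2.1.ge
  | insert a s ha ih =>
    obtain ⟨haN, hs⟩ := Finset.insert_subset_iff.mp hS
    have h := hm.add_le_union (Finset.singleton_subset_iff.mpr haN) hs
      (Finset.disjoint_singleton_left.mpr ha)
    rw [hm.2.2 a haN, ← Finset.insert_eq] at h
    linarith [ih hs]

theorem Kl.mono {α : Type*} [DecidableEq α] {N M : Finset α} {m : Finset α → ℝ}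
    (hm : Kl N m) (hMN : M ⊆ N) : Kl M m :=
  ⟨fun A hA B hB => hm.1 A (hA.trans hMN) B (hB.trans hMN), hm.2.1,
    fun i hi => hm.2.2 i (hMN hi)⟩

theorem Kl.lift {α : Type*} [DecidableEq α] {M : Finset α} {r : Finset α → ℝ}
    (hr : Kl M r) (N : Finset α) : Kl N (fun S => r (S ∩ M)) := by
  refine ⟨fun A _ B _ => ?_, ?_, fun i _ => ?_⟩
  · have h := hr.1 (A ∩ M) Finset.inter_subset_right (B ∩ M) Finset.inter_subset_right
    rwa [← Finset.union_inter_distrib_right, ← Finset.inter_inter_distrib_right] at h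
  · simpa using hr.2.1
  · by_cases hi : i ∈ M
    · simpa [Finset.singleton_inter_of_mem hi] using hr.2.2 i hi
    · simpa [Finset.singleton_inter_of_notMem hi] using hr.2.1

/-- The summands in a decomposition of a lifted function are themselves lifted. -/
theorem Kl.eq_inter_of_add_eq_lift {α : Type*} [DecidableEq α] {N M : Finset α}
    {r m₁ m₂ : Finset α → ℝ} (h₁ : Kl N m₁) (h₂ : Kl N m₂)
    (hadd : ∀ S ⊆ N, r (S ∩ M) = m₁ S + m₂ S) {S : Finset α} (hS : S ⊆ N) :
    m₁ S = m₁ (S ∩ M) ∧ m₂ S = m₂ (S ∩ M) := by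
  have hI : S ∩ M ⊆ N := Finset.inter_subset_left.trans hS
  have hD : S \ M ⊆ N := Finset.sdiff_subset.trans hS
  have hdisj : Disjoint (S ∩ M) (S \ M) := (Finset.disjoint_sdiff_inter S M).symm
  have hunion : S ∩ M ∪ S \ M = S := by rw [Finset.union_comm, Finset.sdiff_union_inter]
  have e₁ := h₁.add_le_union hI hD hdisj
  have e₂ := h₂.add_le_union hI hD hdisj
  rw [hunion] at e₁ e₂
  have aS := hadd S hS
  have aI := hadd (S ∩ M) hI
  rw [Finset.inter_assoc, Finset.inter_self] at aI
  have n₁ := h₁.nonneg hD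
  have n₂ := h₂.nonneg hD
  constructor <;> linarith

/-- The lifting `λ(r)(S) = r (S ∩ M)` maps `K_ℓ(M)` into `K_ℓ(N)` and
preserves extremality in both directions. -/
theorem lifting_preserves_Kl_and_extremality
    {α : Type*} [DecidableEq α] (N M : Finset α) (hMN : M ⊆ N)
    (r : Finset α → ℝ) (hr : Kl M r) :
    Kl N (fun S => r (S ∩ M)) ∧
    (ExtremeRay M (Kl M) r ↔ ExtremeRay N (Kl N) (fun S => r (S ∩ M))) := by
  refine ⟨hr.lift N, ?_, ?_⟩
  · rintro ⟨-, ⟨S, hS, hne⟩, hext⟩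
    refine ⟨hr.lift N, ⟨S, hS.trans hMN, ?_⟩, fun m₁ m₂ h₁ h₂ hadd => ?_⟩
    · simpa [Finset.inter_eq_left.mpr hS] using hne
    · obtain ⟨a, b, ha, hb, ea, eb⟩ := hext m₁ m₂ (h₁.mono hMN) (h₂.mono hMN) fun T hT => by
        simpa [Finset.inter_eq_left.mpr hT] using hadd T (hT.trans hMN)
      refine ⟨a, b, ha, hb, fun T hT => ?_, fun T hT => ?_⟩
      · rw [(Kl.eq_inter_of_add_eq_lift h₁ h₂ hadd hT).1]
        exact ea _ Finset.inter_subset_right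
      · rw [(Kl.eq_inter_of_add_eq_lift h₁ h₂ hadd hT).2]
        exact eb _ Finset.inter_subset_right
  · rintro ⟨-, ⟨S, -, hne⟩, hext⟩
    refine ⟨hr, ⟨S ∩ M, Finset.inter_subset_right, hne⟩, fun m₁ m₂ h₁ h₂ hadd => ?_⟩
    obtain ⟨a, b, ha, hb, ea, eb⟩ := hext _ _ (h₁.lift N) (h₂.lift N) fun T _ =>
      hadd (T ∩ M) Finset.inter_subset_right
    refine ⟨a, b, ha, hb, fun T hT => ?_, fun T hT => ?_⟩
    · simpa [Finset.inter_eq_left.mpr hT] using ea T (hT.trans hMN)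
    · simpa [Finset.inter_eq_left.mpr hT] using eb T (hT.trans hMN)
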